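/- arXiv:2505.11259 — 4 statements merged into one kernel-verified Lean document; each statement's English description precedes it below -/
import Mathlib

section
/- Let P be a polytope in ℝⁿ (n ≥ 1) with at least two vertices whose affine span is all of ℝⁿ. Let f be a face of P attaining the minimum in the affine pyramidal width δ̄(P), and suppose p ∈ aff(f) and q ∈ P^f satisfy ‖p − q‖ = dist(aff(f), P^f). Then p lies in the relative (intrinsic) interior of f. -/
section Defs

variable {E : Type*} [NormedAddCommGroup E] [InnerProductSpace ℝ E]

/-- The (Euclidean) distance between two sets. -/
noncomputable def setDist {X : Type*} [PseudoMetricSpace X] (A B : Set X) : ℝ :=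
  sInf ((fun p : X × X => dist p.1 p.2) '' (A ×ˢ B))

/-- A polytope: the convex hull of a nonempty finite set of points. -/
def IsPolytope (S : Set E) : Prop :=
  ∃ V : Set E, V.Finite ∧ V.Nonempty ∧ S = convexHull ℝ V

/-- A face of `P`: a nonempty proper exposed face. -/
def IsFaceOf (P f : Set E) : Prop :=
  IsExposed ℝ P f ∧ f.Nonempty ∧ f ≠ P

/-- `P^f = conv(V(P) \ V(f))`, where `V(·)` denotes the set of extreme points. -/
noncomputable def compPoly (P f : Set E) : Set E :=
  convexHull ℝ (P.extremePoints ℝ \ f.extremePoints ℝ)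

/-- The affine pyramidal width `δ̄(P) = min over faces f of dist(aff(f), P^f)`. -/
noncomputable def affPyramidalWidth (P : Set E) : ℝ :=
  sInf {d : ℝ | ∃ f : Set E, IsFaceOf P f ∧ d = setDist (affineSpan ℝ f : Set E) (compPoly P f)}

end Defs

section Separation

variable {E : Type*} [NormedAddCommGroup E] [NormedSpace ℝ E]

/-- The ray from an interior point of a closed convex set through a point outside the interior
meets a supporting hyperplane of the set. -/
lemma Convex.exists_supporting_on_ray {S : Set E} (hS : Convex ℝ S) (hcl : IsClosed S)
    (h0 : (0 : E) ∈ interior S) {x : E} (hx : x ∉ interior S) :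
    ∃ c : ℝ, 0 < c ∧ c ≤ 1 ∧ c • x ∈ S ∧
      ∃ l : E →L[ℝ] ℝ, (∀ y ∈ S, l y ≤ l (c • x)) ∧ 0 < l (c • x) := by
  have hnhds : S ∈ nhds 0 := mem_interior_iff_mem_nhds.1 h0
  have hγ : 1 ≤ gauge S x := by
    by_contra! h
    exact hx ((gauge_lt_one_iff_mem_interior hS hnhds).1 h)
  have hpos : 0 < gauge S x := by linarith
  have hfr : (gauge S x)⁻¹ • x ∈ frontier S := by
    rw [← gauge_eq_one_iff_mem_frontier hS hnhds, gauge_smul_of_nonneg (inv_pos.2 hpos).le,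
      smul_eq_mul, inv_mul_cancel₀ hpos.ne']
  obtain ⟨l, hl⟩ := geometric_hahn_banach_open_point hS.interior isOpen_interior hfr.2
  refine ⟨_, inv_pos.2 hpos, inv_le_one_of_one_le₀ hγ, hcl.frontier_subset hfr, l, ?_, ?_⟩
  · intro y hy
    have hy' : y ∈ closure (interior S) := by
      rw [hS.closure_interior_eq_closure_of_nonempty_interior ⟨0, h0⟩]
      exact subset_closure hy
    exact closure_minimal (t := {y | l y ≤ l ((gauge S x)⁻¹ • x)}) (fun a ha => (hl a ha).le)
      (isClosed_le l.continuous continuous_const) hy'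
  · simpa using hl 0 h0

/-- In the coordinates of the direction space based at `z`, the intrinsic interior becomes an
ordinary interior. -/
lemma mem_interior_direction_iff {f : Set E} {z : E} (hz : z ∈ affineSpan ℝ f)
    (x : (affineSpan ℝ f).direction) :
    x ∈ interior {y : (affineSpan ℝ f).direction | (y : E) + z ∈ f} ↔
      (x : E) + z ∈ intrinsicInterior ℝ f := by
  have : Nonempty (affineSpan ℝ f) := ⟨⟨z, hz⟩⟩
  let h := (IsometryEquiv.vaddConst (⟨z, hz⟩ : affineSpan ℝ f)).toHomeomorph
  have hpre : {y : (affineSpan ℝ f).direction | (y : E) + z ∈ f} =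
      h ⁻¹' ((↑) ⁻¹' f : Set (affineSpan ℝ f)) := rfl
  rw [hpre, ← h.preimage_interior, mem_intrinsicInterior]
  constructor
  · intro hx
    exact ⟨h x, hx, rfl⟩
  · rintro ⟨y, hy, hyx⟩
    have : h x = y := Subtype.ext hyx.symm
    rw [Set.mem_preimage, this]
    exact hy

/-- A point of the affine span of a compact convex set outside its intrinsic interior is separated
from the intrinsic interior by a hyperplane supporting the set along a ray. -/
lemma exists_supporting_of_notMem_intrinsicInterior [FiniteDimensional ℝ E] {f : Set E}
    (hconv : Convex ℝ f) (hcl : IsClosed f) (hne : f.Nonempty) {p : E}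
    (hp : p ∈ affineSpan ℝ f) (hpi : p ∉ intrinsicInterior ℝ f) :
    ∃ z ∈ f, ∃ c : ℝ, 0 < c ∧ c ≤ 1 ∧ z + c • (p - z) ∈ f ∧
      ∃ l : E →L[ℝ] ℝ, (∀ y ∈ f, l y ≤ l (z + c • (p - z))) ∧ l z < l (z + c • (p - z)) := by
  obtain ⟨z, hzi⟩ := hne.intrinsicInterior hconv
  have hzf : z ∈ f := intrinsicInterior_subset hzi
  have hz : z ∈ affineSpan ℝ f := subset_affineSpan ℝ f hzf
  let S := {y : (affineSpan ℝ f).direction | (y : E) + z ∈ f}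
  have hSconv : Convex ℝ S := by
    intro a ha b hb s t hs ht hst
    have := hconv ha hb hs ht hst
    change ((s • a + t • b : (affineSpan ℝ f).direction) : E) + z ∈ f
    convert this using 1
    obtain rfl : t = 1 - s := by linarith
    push_cast
    module
  have hScl : IsClosed S := hcl.preimage (by fun_prop)
  let x : (affineSpan ℝ f).direction := ⟨p - z, AffineSubspace.vsub_mem_direction hp hz⟩
  have h0 : (0 : (affineSpan ℝ f).direction) ∈ interior S := by
    rw [mem_interior_direction_iff hz]
    simpa using hzi
  have hx : x ∉ interior S := by
    rw [mem_interior_direction_iff hz]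
    simpa [x] using hpi
  obtain ⟨c, hc0, hc1, hcS, l, hl, hl0⟩ := hSconv.exists_supporting_on_ray hScl h0 hx
  obtain ⟨l', hl', -⟩ := exists_extension_norm_eq _ l
  have hlx : l' (c • (p - z)) = l (c • x) := hl' (c • x)
  refine ⟨z, hzf, c, hc0, hc1, ?_, l', ?_, ?_⟩
  · rw [add_comm]
    exact hcS
  · intro y hy
    let y' : (affineSpan ℝ f).direction :=
      ⟨y - z, AffineSubspace.vsub_mem_direction (subset_affineSpan ℝ f hy) hz⟩
    have h1 : l' (y - z) = l y' := hl' y'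
    have h2 := hl y' (by simpa [S, y'] using hy)
    rw [map_add, hlx]
    rw [map_sub] at h1
    linarith
  · rw [map_add, hlx]
    linarith

end Separation

section Faces

variable {E : Type*} [NormedAddCommGroup E] [InnerProductSpace ℝ E]

lemma IsPolytope.finite_extremePoints {P : Set E} (hP : IsPolytope P) :
    (P.extremePoints ℝ).Finite := by
  obtain ⟨V, hV, -, rfl⟩ := hP
  exact hV.subset extremePoints_convexHull_subset

lemma IsPolytope.isCompact {P : Set E} (hP : IsPolytope P) : IsCompact P := by
  obtain ⟨V, hV, -, rfl⟩ := hP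
  exact hV.isCompact_convexHull ℝ

lemma IsPolytope.convex {P : Set E} (hP : IsPolytope P) : Convex ℝ P := by
  obtain ⟨V, -, -, rfl⟩ := hP
  exact convex_convexHull ℝ V

/-- Krein-Milman for compact convex sets with finitely many extreme points. -/
lemma convexHull_extremePoints_of_finite {f : Set E} (hf : IsCompact f) (hconv : Convex ℝ f)
    (hfin : (f.extremePoints ℝ).Finite) : convexHull ℝ (f.extremePoints ℝ) = f := by
  rw [← (hfin.isClosed_convexHull ℝ).closure_eq]
  exact closure_convexHull_extremePoints hf hconv

lemma IsFaceOf.extremePoints_eq {P f : Set E} (hf : IsFaceOf P f) :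
    f.extremePoints ℝ = f ∩ P.extremePoints ℝ :=
  hf.1.isExtreme.extremePoints_eq

/-- A proper exposed face of a face of a polytope is a face of the polytope. -/
lemma IsFaceOf.trans {P f : Set E} (hP : IsPolytope P) (hf : IsFaceOf P f) (l : E →L[ℝ] ℝ)
    {w z : E} (hw : w ∈ f) (hz : z ∈ f) (hl : ∀ y ∈ f, l y ≤ l w) (hlz : l z < l w) :
    IsFaceOf P {y ∈ f | l y = l w} := by
  obtain ⟨m, hm⟩ := hf.1 hf.2.1
  have hfP : f ⊆ P := hf.1.subset
  have hmw : ∀ y ∈ P, m y ≤ m w := by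
    rw [hm] at hw
    exact hw.2
  have hmf : ∀ y ∈ P, m y = m w → y ∈ f := by
    intro y hy hyw
    rw [hm]
    exact ⟨hy, fun x hx => hyw ▸ hmw x hx⟩
  have hfm : ∀ y ∈ f, m y = m w := by
    intro y hy
    refine le_antisymm (hmw y (hfP hy)) ?_
    rw [hm] at hy
    exact hy.2 w (hfP hw)
  have hev : ∀ v ∈ P.extremePoints ℝ, ∀ᶠ N : ℝ in Filter.atTop,
      l v + N * m v ≤ l w + N * m w := by
    intro v hv
    rcases (hmw v hv.1).eq_or_lt with h | h
    · refine Filter.Eventually.of_forall fun N => ?_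
      rw [h]
      linarith [hl v (hmf v hv.1 h)]
    · filter_upwards [Filter.eventually_ge_atTop ((l v - l w) / (m w - m v))] with N hN
      rw [div_le_iff₀ (sub_pos.2 h)] at hN
      linarith
  obtain ⟨N, hN⟩ := ((Filter.eventually_all_finite hP.finite_extremePoints).2 hev).exists
  have hNP : ∀ x ∈ P, l x + N * m x ≤ l w + N * m w := by
    intro x hx
    rw [← convexHull_extremePoints_of_finite hP.isCompact hP.convex
      hP.finite_extremePoints] at hx
    exact convexHull_min (t := {x | (l + N • m) x ≤ l w + N * m w}) (fun v hv => hN v hv)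
      (convex_halfSpace_le (l + N • m).isLinear _) hx
  refine ⟨fun _ => ⟨l + (N + 1) • m, ?_⟩, ⟨w, hw, rfl⟩, ?_⟩
  · ext x
    simp only [Set.mem_ofPred_eq, add_apply, smul_apply,
      smul_eq_mul]
    constructor
    · rintro ⟨hx, hxl⟩
      refine ⟨hfP hx, fun y hy => ?_⟩
      rw [hxl, hfm x hx]
      linarith [hNP y hy, hmw y hy]
    · rintro ⟨hx, hxm⟩
      have h1 := hxm w (hfP hw)
      have h2 := hNP x hx
      have h3 := hmw x hx
      have hxf : x ∈ f := hmf x hx (by linarith)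
      refine ⟨hxf, le_antisymm (hl x hxf) ?_⟩
      rw [hfm x hxf] at h1
      linarith
  · intro h
    exact hlz.ne (h.symm ▸ hfP hz : z ∈ {y ∈ f | l y = l w}).2

end Faces

section Distance

lemma setDist_nonneg {X : Type*} [PseudoMetricSpace X] (A B : Set X) : 0 ≤ setDist A B := by
  apply Real.sInf_nonneg
  rintro _ ⟨x, -, rfl⟩
  exact dist_nonneg

lemma setDist_le_dist {X : Type*} [PseudoMetricSpace X] {A B : Set X} {a b : X} (ha : a ∈ A)
    (hb : b ∈ B) : setDist A B ≤ dist a b := by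
  refine csInf_le ⟨0, ?_⟩ ⟨(a, b), ⟨ha, hb⟩, rfl⟩
  rintro _ ⟨x, -, rfl⟩
  exact dist_nonneg

variable {E : Type*} [NormedAddCommGroup E] [InnerProductSpace ℝ E]

lemma affPyramidalWidth_le {P f : Set E} (hf : IsFaceOf P f) :
    affPyramidalWidth P ≤ setDist (affineSpan ℝ f : Set E) (compPoly P f) := by
  refine csInf_le ⟨0, ?_⟩ ⟨f, hf, rfl⟩
  rintro _ ⟨g, -, rfl⟩
  exact setDist_nonneg _ _

lemma compPoly_subset_compPoly {P f g : Set E} (hf : IsFaceOf P f) (hg : IsFaceOf P g)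
    (hgf : g ⊆ f) : compPoly P f ⊆ compPoly P g := by
  refine convexHull_mono fun v hv => ⟨hv.1, fun hvg => hv.2 ?_⟩
  rw [hg.extremePoints_eq] at hvg
  rw [hf.extremePoints_eq]
  exact ⟨hgf hvg.1, hvg.2⟩

/-- The affine span of a face does not meet the hull of the remaining vertices. -/
lemma IsFaceOf.disjoint_affineSpan_compPoly {P f : Set E} (hf : IsFaceOf P f) :
    Disjoint (affineSpan ℝ f : Set E) (compPoly P f) := by
  obtain ⟨w, hw⟩ := hf.2.1
  obtain ⟨m, hm⟩ := hf.1 hf.2.1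
  rw [Set.disjoint_left]
  intro x hxf hx
  have hw' := hw
  rw [hm] at hw'
  have hfm : ∀ y ∈ f, m y = m w := by
    intro y hy
    rw [hm] at hy
    exact le_antisymm (hw'.2 y hy.1) (hy.2 w hw'.1)
  have hxm : m x = m w := by
    have h : affineSpan ℝ f ≤ (AffineSubspace.mk' w (LinearMap.ker (m : E →ₗ[ℝ] ℝ))) := by
      rw [affineSpan_le]
      intro y hy
      rw [SetLike.mem_coe, AffineSubspace.mem_mk']
      simp [hfm y hy]
    have := h hxf
    rw [AffineSubspace.mem_mk'] at this
    simpa [sub_eq_zero] using this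
  have hlt : m x < m w := by
    refine convexHull_min (t := {y | m y < m w}) (fun v hv => ?_)
      (convex_halfSpace_lt m.isLinear _) hx
    refine lt_of_le_of_ne (hw'.2 v hv.1.1) fun h => hv.2 ?_
    rw [hf.extremePoints_eq]
    refine ⟨?_, hv.1⟩
    rw [hm]
    exact ⟨hv.1.1, fun y hy => h ▸ hw'.2 y hy⟩
  exact hlt.ne hxm

/-- A nearest point of an affine subspace is an orthogonal projection. -/
lemma inner_sub_eq_zero_of_forall_norm_le {A : AffineSubspace ℝ E} {p q y : E} (hp : p ∈ A)
    (hy : y ∈ A) (h : ∀ x ∈ A, ‖p - q‖ ≤ ‖x - q‖) : inner ℝ (p - q) (y - p) = 0 := by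
  set I := inner ℝ (p - q) (y - p) with hI
  have key : ∀ t : ℝ, 0 ≤ 2 * t * I + t ^ 2 * ‖y - p‖ ^ 2 := by
    intro t
    have h1 := h _ (AffineMap.lineMap_mem t hp hy)
    have h2 : AffineMap.lineMap p y t - q = (p - q) + t • (y - p) := by
      rw [AffineMap.lineMap_apply_module']
      abel
    rw [h2] at h1
    have h3 := pow_le_pow_left₀ (norm_nonneg _) h1 2
    rw [norm_add_sq_real, inner_smul_right, norm_smul, mul_pow, Real.norm_eq_abs, sq_abs] at h3
    linarith
  by_contra hne
  have hI2 : 0 < I ^ 2 := by positivity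
  have hD : 0 ≤ ‖y - p‖ ^ 2 := by positivity
  have h1 := key (-I / (‖y - p‖ ^ 2 + 1))
  have h2 : 2 * (-I / (‖y - p‖ ^ 2 + 1)) * I + (-I / (‖y - p‖ ^ 2 + 1)) ^ 2 * ‖y - p‖ ^ 2 =
      -(I ^ 2 * (‖y - p‖ ^ 2 + 2)) / (‖y - p‖ ^ 2 + 1) ^ 2 := by
    field_simp
    ring
  rw [h2, neg_div] at h1
  have h3 : 0 < I ^ 2 * (‖y - p‖ ^ 2 + 2) / (‖y - p‖ ^ 2 + 1) ^ 2 := by positivity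
  linarith

/-- In a right triangle `q p z`, every point of the leg `[p, z)` is closer to some point of the
hypotenuse than `p` is to `q`. -/
lemma exists_norm_sub_lineMap_lt {p q z : E} (hpq : p ≠ q) (horth : inner ℝ (p - q) (z - p) = 0)
    {s : ℝ} (hs0 : 0 ≤ s) (hs1 : s < 1) :
    ∃ y ∈ segment ℝ q z, ‖AffineMap.lineMap p z s - y‖ < ‖p - q‖ := by
  have hd : 0 < ‖p - q‖ := norm_pos_iff.2 (sub_ne_zero.2 hpq)
  rcases hs0.eq_or_lt with rfl | hs
  · set d := ‖p - q‖ ^ 2 with hd2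
    set D := ‖z - p‖ ^ 2 with hD2
    have hd' : 0 < d := by positivity
    have hD' : 0 ≤ D := by positivity
    have hτ0 : 0 < d / (d + D) := by positivity
    have hτ1 : d / (d + D) ≤ 1 := by rw [div_le_one (by positivity)]; linarith
    refine ⟨AffineMap.lineMap q z (d / (d + D)), ?_, ?_⟩
    · rw [segment_eq_image_lineMap]
      exact ⟨_, ⟨hτ0.le, hτ1⟩, rfl⟩
    · refine lt_of_pow_lt_pow_left₀ 2 hd.le ?_
      have h1 : AffineMap.lineMap p z (0 : ℝ) - AffineMap.lineMap q z (d / (d + D)) =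
          (1 - d / (d + D)) • (p - q) - (d / (d + D)) • (z - p) := by
        simp only [AffineMap.lineMap_apply_module]
        module
      rw [h1, norm_sub_sq_real, inner_smul_left, inner_smul_right, horth, norm_smul, norm_smul,
        mul_pow, mul_pow, Real.norm_eq_abs, Real.norm_eq_abs, sq_abs, sq_abs, ← hd2, ← hD2]
      have h2 : (1 - d / (d + D)) ^ 2 * d + (d / (d + D)) ^ 2 * D = d - d * (d / (d + D)) := by
        field_simp
        ring
      have h3 : 0 < d * (d / (d + D)) := by positivity
      simp only [mul_zero, sub_zero]
      linarith
  · refine ⟨AffineMap.lineMap q z s, ?_, ?_⟩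
    · rw [segment_eq_image_lineMap]
      exact ⟨_, ⟨hs.le, hs1.le⟩, rfl⟩
    · have h1 : AffineMap.lineMap p z s - AffineMap.lineMap q z s = (1 - s) • (p - q) := by
        simp only [AffineMap.lineMap_apply_module]
        module
      rw [h1, norm_smul, Real.norm_eq_abs, abs_of_pos (by linarith)]
      nlinarith

/-- If `p ∈ aff f` is not in the intrinsic interior of the face `f`, then some smaller face `g`
and some point `z` of the hull of the vertices of `f` outside `g` are such that the half-open
segment `[p, z)` meets `aff g`. -/
lemma IsFaceOf.exists_subface_meeting_segment [FiniteDimensional ℝ E] {P f : Set E}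
    (hP : IsPolytope P) (hf : IsFaceOf P f) {p : E} (hp : p ∈ affineSpan ℝ f)
    (hpi : p ∉ intrinsicInterior ℝ f) :
    ∃ g ⊆ f, IsFaceOf P g ∧ ∃ z ∈ f, z ∈ compPoly P g ∧
      ∃ s : ℝ, 0 ≤ s ∧ s < 1 ∧ AffineMap.lineMap p z s ∈ affineSpan ℝ g := by
  have hfc : IsCompact f := hf.1.isCompact hP.isCompact
  have hfconv : Convex ℝ f := hf.1.convex hP.convex
  have hffin : (f.extremePoints ℝ).Finite := by
    rw [hf.extremePoints_eq]
    exact hP.finite_extremePoints.inter_of_right _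
  have hfhull := convexHull_extremePoints_of_finite hfc hfconv hffin
  obtain ⟨z, hz, c, hc0, hc1, hw, l, hl, hlz⟩ :=
    exists_supporting_of_notMem_intrinsicInterior hfconv hfc.isClosed hf.2.1 hp hpi
  set w := z + c • (p - z) with hwdef
  set g := {y ∈ f | l y = l w} with hgdef
  have hgf : g ⊆ f := fun y hy => hy.1
  have hg : IsFaceOf P g := hf.trans hP l hw hz hl hlz
  have hgc : IsCompact g := hg.1.isCompact hP.isCompact
  have hgconv : Convex ℝ g := hg.1.convex hP.convex
  have hgfin : (g.extremePoints ℝ).Finite := by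
    rw [hg.extremePoints_eq]
    exact hP.finite_extremePoints.inter_of_right _
  have hghull := convexHull_extremePoints_of_finite hgc hgconv hgfin
  have hsub : g.extremePoints ℝ ⊆ f.extremePoints ℝ := by
    rw [hg.extremePoints_eq, hf.extremePoints_eq]
    exact Set.inter_subset_inter_left _ hgf
  have hgne : (g.extremePoints ℝ).Nonempty := by
    rw [← convexHull_nonempty_iff (𝕜 := ℝ), hghull]
    exact hg.2.1
  have hdne : (f.extremePoints ℝ \ g.extremePoints ℝ).Nonempty := by
    rw [Set.sdiff_nonempty]
    intro h
    have : z ∈ g := by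
      rw [← hghull]
      rw [← hfhull] at hz
      exact convexHull_mono h hz
    exact hlz.ne this.2
  have hzj := hz
  rw [← hfhull, ← Set.union_sdiff_cancel hsub, convexHull_union hgne hdne, hghull,
    mem_convexJoin] at hzj
  obtain ⟨y, hy, z', hz', a, b, ha, hb, hab, rfl⟩ := hzj
  have hb' : b ≠ 0 := by
    rintro rfl
    obtain rfl : a = 1 := by linarith
    rw [one_smul, zero_smul, add_zero, hy.2] at hlz
    exact hlz.false
  have hz'f : z' ∈ f := by
    rw [← hfhull]
    exact convexHull_mono Set.sdiff_subset hz'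
  have hz'P : z' ∈ compPoly P g := by
    refine convexHull_mono (Set.sdiff_subset_sdiff_left ?_) hz'
    rw [hf.extremePoints_eq]
    exact Set.inter_subset_right
  have hk : 0 < (1 - c) * b + c := by nlinarith
  refine ⟨g, hgf, hg, z', hz'f, hz'P, (1 - c) * b / ((1 - c) * b + c), ?_, ?_, ?_⟩
  · exact div_nonneg (mul_nonneg (by linarith) hb) hk.le
  · rw [div_lt_one hk]
    linarith
  · have hwg : w ∈ affineSpan ℝ g := subset_affineSpan ℝ g ⟨hw, rfl⟩
    have hyg : y ∈ affineSpan ℝ g := subset_affineSpan ℝ g hy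
    convert AffineMap.lineMap_mem (1 / ((1 - c) * b + c)) hyg hwg using 1
    rw [hwdef]
    obtain rfl : a = 1 - b := by linarith
    simp only [AffineMap.lineMap_apply_module]
    match_scalars <;> field_simp <;> ring

end Distance

/-- Let `P` be a full-dimensional polytope in `ℝⁿ` (`n ≥ 1`) with at least two vertices,
let `f` be a face attaining the minimum in the affine pyramidal width, and let
`p ∈ aff(f)`, `q ∈ P^f` realize the minimum distance `dist(aff(f), P^f)`. Then `p` lies
in the relative (intrinsic) interior of `f`. -/
theorem affPyramidalWidth_realized_in_relintGe
    (n : ℕ) (hn : 1 ≤ n) (P f : Set (EuclideanSpace ℝ (Fin n)))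
    (hP : IsPolytope P) (hv : (P.extremePoints ℝ).Nontrivial)
    (hfull : affineSpan ℝ P = ⊤)
    (hf : IsFaceOf P f)
    (hmin : setDist (affineSpan ℝ f : Set (EuclideanSpace ℝ (Fin n))) (compPoly P f) =
      affPyramidalWidth P)
    (p q : EuclideanSpace ℝ (Fin n))
    (hp : p ∈ (affineSpan ℝ f : Set (EuclideanSpace ℝ (Fin n))))
    (hq : q ∈ compPoly P f)
    (hpq : ‖p - q‖ = setDist (affineSpan ℝ f : Set (EuclideanSpace ℝ (Fin n))) (compPoly P f)) :
    p ∈ intrinsicInterior ℝ f := by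
  by_contra hpi
  obtain ⟨g, hgf, hg, z, hzf, hzg, s, hs0, hs1, hsg⟩ :=
    hf.exists_subface_meeting_segment hP hp hpi
  have hne : p ≠ q := by
    rintro rfl
    exact Set.disjoint_left.1 hf.disjoint_affineSpan_compPoly hp hq
  have horth : inner ℝ (p - q) (z - p) = 0 := by
    refine inner_sub_eq_zero_of_forall_norm_le hp (subset_affineSpan ℝ f hzf) fun x hx => ?_
    rw [hpq, ← dist_eq_norm]
    exact setDist_le_dist hx hq
  obtain ⟨y, hy, hlt⟩ := exists_norm_sub_lineMap_lt hne horth hs0 hs1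
  have hyg : y ∈ compPoly P g :=
    (convex_convexHull ℝ _).segment_subset (compPoly_subset_compPoly hf hg hgf hq) hzg hy
  have hle := (affPyramidalWidth_le hg).trans (setDist_le_dist hsg hyg)
  rw [dist_eq_norm, ← hmin, ← hpq] at hle
  exact hle.not_gt hlt
end

section
/- Let E be a real inner product space, x, x* ∈ E with x ≠ x*, g ∈ E, and h, μ, δ, s ∈ ℝ with μ > 0 and δ > 0. Assume h ≥ 0, ⟪g, x − x*⟫ ≥ h (the gradient inequality of convexity at a minimizer), h ≥ (μ/2)·‖x − x*‖² (μ-quadratic growth), and s ≥ δ·⟪g, x − x*⟫/‖x − x*‖ (the scaling inequality with pyramidal width δ). Then s² ≥ (δ²μ/2)·h. -/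
open scoped RealInnerProductSpace

/-- The key inequality for linear convergence of Away Frank-Wolfe: from the gradient
inequality of convexity at a minimizer, `μ`-quadratic growth, and the scaling inequality
with pyramidal width `δ`, one gets `s² ≥ (δ²μ/2)·h`. -/
theorem afw_key_inequality {E : Type*} [NormedAddCommGroup E] [InnerProductSpace ℝ E]
    (x xstar g : E) (h μ δ s : ℝ)
    (hne : x ≠ xstar) (hμ : 0 < μ) (hδ : 0 < δ)
    (hh : 0 ≤ h)
    (hconv : ⟪g, x - xstar⟫ ≥ h)
    (hqg : h ≥ μ / 2 * ‖x - xstar‖ ^ 2)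
    (hscal : s ≥ δ * ⟪g, x - xstar⟫ / ‖x - xstar‖) :
    s ^ 2 ≥ δ ^ 2 * μ / 2 * h := by
  have hd : 0 < ‖x - xstar‖ := norm_sub_pos_iff.mpr hne
  have hs : δ * h ≤ s * ‖x - xstar‖ :=
    (mul_le_mul_of_nonneg_left hconv hδ.le).trans ((div_le_iff₀ hd).mp hscal)
  refine le_of_mul_le_mul_right ?_ (pow_pos hd 2)
  calc δ ^ 2 * μ / 2 * h * ‖x - xstar‖ ^ 2
      = δ ^ 2 * h * (μ / 2 * ‖x - xstar‖ ^ 2) := by ring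
    _ ≤ δ ^ 2 * h * h := mul_le_mul_of_nonneg_left hqg (by positivity)
    _ = (δ * h) ^ 2 := by ring
    _ ≤ (s * ‖x - xstar‖) ^ 2 := pow_le_pow_left₀ (by positivity) hs 2
    _ = s ^ 2 * ‖x - xstar‖ ^ 2 := by ring
end

section
/- Let E be a real inner product space, L, μ, δ, D, Λ, h > 0, and f : E → ℝ a differentiable function satisfying f(y) ≤ f(z) + ⟪∇f(z), y − z⟫ + (L/2)‖y − z‖² for all y, z ∈ E. Let x, d ∈ E with d ≠ 0, ‖d‖ ≤ D, h ≤ ⟪∇f(x), d⟫, and ⟪∇f(x), d⟫² ≥ (δ²μ/8)·h. Set λ := min{Λ, ⟪∇f(x), d⟫/(L‖d‖²)}. Then f(x) − f(x − λd) ≥ min{ Λ·h/2, (δ²μ/(16·L·D²))·h }. -/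
open scoped RealInnerProductSpace

/-- A step of size `t` along `-d` decreases a function satisfying the quadratic upper bound by at
least `t * ⟪v, d⟫ - L / 2 * t ^ 2 * ‖d‖ ^ 2`. -/
theorem sub_smul_progress_of_quadratic_bound {E : Type*} [NormedAddCommGroup E]
    [InnerProductSpace ℝ E] {L t : ℝ} {f : E → ℝ} {v x d : E}
    (h : ∀ y : E, f y ≤ f x + ⟪v, y - x⟫ + L / 2 * ‖y - x‖ ^ 2) :
    t * ⟪v, d⟫ - L / 2 * t ^ 2 * ‖d‖ ^ 2 ≤ f x - f (x - t • d) := by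
  have key := h (x - t • d)
  rw [sub_sub_cancel_left, inner_neg_right, real_inner_smul_right, norm_neg, norm_smul, mul_pow,
    Real.norm_eq_abs, sq_abs] at key
  linarith

/-- Per-iteration progress bound of Away Frank-Wolfe with the short-step rule on a polytope
of diameter at most `D` and pyramidal width `δ`, for an `L`-smooth objective: with
`λ = min{Λ, ⟪∇f(x), d⟫/(L‖d‖²)}` one has
`f(x) − f(x − λd) ≥ min{Λ·h/2, (δ²μ/(16·L·D²))·h}`. -/
theorem afw_per_iteration_progress {E : Type*} [NormedAddCommGroup E] [InnerProductSpace ℝ E]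
    (L μ δ D Lam h : ℝ) (hL : 0 < L) (hμ : 0 < μ) (hδ : 0 < δ) (hD : 0 < D)
    (hLam : 0 < Lam) (hh : 0 < h)
    (f : E → ℝ) (g : E → E)
    (hgrad : ∀ z : E, HasFDerivAt f (innerSL ℝ (g z)) z)
    (hsmooth : ∀ y z : E, f y ≤ f z + ⟪g z, y - z⟫ + L / 2 * ‖y - z‖ ^ 2)
    (x d : E) (hd : d ≠ 0) (hdD : ‖d‖ ≤ D)
    (hconv : h ≤ ⟪g x, d⟫)
    (hscal : ⟪g x, d⟫ ^ 2 ≥ δ ^ 2 * μ / 8 * h) :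
    f x - f (x - (min Lam (⟪g x, d⟫ / (L * ‖d‖ ^ 2))) • d) ≥
      min (Lam * h / 2) (δ ^ 2 * μ / (16 * L * D ^ 2) * h) := by
  have hn : 0 < ‖d‖ ^ 2 := by positivity
  have hnD : ‖d‖ ^ 2 ≤ D ^ 2 := by gcongr
  refine le_trans ?_ (sub_smul_progress_of_quadratic_bound fun y => hsmooth y x)
  generalize ⟪g x, d⟫ = s at *
  generalize ‖d‖ ^ 2 = n at *
  rcases le_total Lam (s / (L * n)) with hle | hle
  · rw [min_eq_left hle]
    refine (min_le_left _ _).trans ?_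
    rw [le_div_iff₀ (by positivity)] at hle
    nlinarith [mul_le_mul_of_nonneg_left hle hLam.le, mul_le_mul_of_nonneg_left hconv hLam.le]
  · rw [min_eq_right hle]
    refine (min_le_right _ _).trans ?_
    calc δ ^ 2 * μ / (16 * L * D ^ 2) * h
        = δ ^ 2 * μ / 8 * h / (2 * L * D ^ 2) := by field_simp; norm_num
      _ ≤ s ^ 2 / (2 * L * n) := by gcongr
      _ = s / (L * n) * s - L / 2 * (s / (L * n)) ^ 2 * n := by field_simp; ring
end

section
/- Let E and F be real inner product spaces, p₁, q₁ ∈ E with ‖p₁ − q₁‖ = δ₁ > 0, and p₂, q₂ ∈ F with ‖p₂ − q₂‖ = δ₂ > 0. In E × F with the ℓ² product norm, let q := (δ₁²/(δ₁² + δ₂²))·(p₁, q₂) + (δ₂²/(δ₁² + δ₂²))·(q₁, p₂). Then ‖(p₁, p₂) − q‖ = δ₁·δ₂/√(δ₁² + δ₂²). -/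
/-- The upper-bound construction for the pyramidal width of a product: the interpolated
point `q` between `(p₁, q₂)` and `(q₁, p₂)` is at distance `δ₁δ₂/√(δ₁² + δ₂²)` from
`(p₁, p₂)` in the ℓ² product norm. -/
theorem product_pyramidal_width_construction
    {E F : Type*} [NormedAddCommGroup E] [InnerProductSpace ℝ E]
    [NormedAddCommGroup F] [InnerProductSpace ℝ F]
    (p₁ q₁ : E) (p₂ q₂ : F) (δ₁ δ₂ : ℝ) (hδ₁ : 0 < δ₁) (hδ₂ : 0 < δ₂)
    (h₁ : ‖p₁ - q₁‖ = δ₁) (h₂ : ‖p₂ - q₂‖ = δ₂) :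
    ‖(WithLp.equiv 2 (E × F)).symm (p₁, p₂) -
        ((δ₁ ^ 2 / (δ₁ ^ 2 + δ₂ ^ 2)) • (WithLp.equiv 2 (E × F)).symm (p₁, q₂) +
          (δ₂ ^ 2 / (δ₁ ^ 2 + δ₂ ^ 2)) • (WithLp.equiv 2 (E × F)).symm (q₁, p₂))‖ =
      δ₁ * δ₂ / Real.sqrt (δ₁ ^ 2 + δ₂ ^ 2) := by
  have hs : 0 < δ₁ ^ 2 + δ₂ ^ 2 := by positivity
  set a := δ₁ ^ 2 / (δ₁ ^ 2 + δ₂ ^ 2) with ha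
  set b := δ₂ ^ 2 / (δ₁ ^ 2 + δ₂ ^ 2) with hb
  have hab : a + b = 1 := by
    rw [ha, hb]
    field_simp
  have hfst : p₁ - (a • p₁ + b • q₁) = b • (p₁ - q₁) := by
    rw [eq_sub_of_add_eq hab]
    module
  have hsnd : p₂ - (a • q₂ + b • p₂) = a • (p₂ - q₂) := by
    rw [eq_sub_of_add_eq' hab]
    module
  have hv : (WithLp.equiv 2 (E × F)).symm (p₁, p₂) -
      (a • (WithLp.equiv 2 (E × F)).symm (p₁, q₂) + b • (WithLp.equiv 2 (E × F)).symm (q₁, p₂)) =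
      WithLp.toLp 2 (b • (p₁ - q₁), a • (p₂ - q₂)) := by
    rw [← hfst, ← hsnd]
    rfl
  rw [hv, WithLp.prod_norm_eq_of_L2]
  simp only [WithLp.toLp_fst, WithLp.toLp_snd, norm_smul, h₁, h₂, mul_pow, Real.norm_eq_abs, sq_abs]
  rw [← Real.sqrt_sq (mul_pos hδ₁ hδ₂).le, ← Real.sqrt_div (sq_nonneg _)]
  congr 1
  rw [ha, hb]
  field_simp
  ring
end
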